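/- arXiv:2001.00799 — 2 statements merged into one kernel-verified Lean document; each statement's English description precedes it below -/
import Mathlib

section
/- If ρ_{AB₁B₂} is pure, then the extra term in the tripartite bound is nonpositive: I(A:B₁)_ω − I(B₁:B₂)_ρ + S(A|B₁B₂)_ρ = −S(B₁|A)_ω − S(B₂)_ω ≤ 0, where the inequality S(B₁|A)_ω ≥ 0 holds because ω_{AB₁} is classical on A (a direct sum of states indexed by the eigenbasis of G). -/
open scoped Kronecker Classical ComplexOrder
open Matrix

noncomputable section

/-- The rank-one projector `|v⟩⟨v|`. -/
def proj {α : Type*} (v : α → ℂ) : Matrix α α ℂ := Matrix.vecMulVec v (star v)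

/-- Matrix logarithm of a Hermitian matrix, via the spectral decomposition
(junk value `0` on non-Hermitian matrices; eigenvalue `0` contributes `log 0 = 0`). -/
def mlog {n : Type*} [Fintype n] [DecidableEq n] (ρ : Matrix n n ℂ) : Matrix n n ℂ :=
  if h : ρ.IsHermitian then
    (h.eigenvectorUnitary : Matrix n n ℂ) *
      Matrix.diagonal (fun i => (Real.log (h.eigenvalues i) : ℂ)) *
      (h.eigenvectorUnitary : Matrix n n ℂ)ᴴ
  else 0

/-- Von Neumann entropy `S(ρ) = -Tr ρ log ρ`. -/
def vN {n : Type*} [Fintype n] [DecidableEq n] (ρ : Matrix n n ℂ) : ℝ :=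
  -(Matrix.trace (ρ * mlog ρ)).re

/-- Quantum relative entropy `D(ρ‖σ) = Tr ρ (log ρ - log σ)`. -/
def relent {n : Type*} [Fintype n] [DecidableEq n] (ρ σ : Matrix n n ℂ) : ℝ :=
  (Matrix.trace (ρ * (mlog ρ - mlog σ))).re

/-- The rotation `e^{-iGr}` generated by the Hermitian operator `G` with orthonormal
eigenbasis `g` and eigenvalues `gv`. -/
def Urot {iA : Type*} [Fintype iA] (g : iA → iA → ℂ) (gv : iA → ℝ) (r : ℝ) : Matrix iA iA ℂ :=
  ∑ l, Complex.exp (-(Complex.I) * (gv l) * r) • proj (g l)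

section Tripartite

variable {iR iA iB1 iB2 : Type*} [Fintype iR] [Fintype iA] [Fintype iB1] [Fintype iB2]
  [DecidableEq iR] [DecidableEq iA] [DecidableEq iB1] [DecidableEq iB2]

/-- `e^{-iGr} ⊗ I_{B₁} ⊗ I_{B₂}`. -/
def UA3
    (g : iA → iA → ℂ) (gv : iA → ℝ) (r : ℝ) :
    Matrix ((iA × iB1) × iB2) ((iA × iB1) × iB2) ℂ :=
  (Urot g gv r ⊗ₖ (1 : Matrix iB1 iB1 ℂ)) ⊗ₖ (1 : Matrix iB2 iB2 ℂ)

/-- `κ_{RAB₁B₂} = Σ_k p_k |r_k⟩⟨r_k| ⊗ (e^{-iGr_k}⊗I) ρ (e^{iGr_k}⊗I)`. -/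
def kappa3
    (p : iR → ℝ) (rb : iR → iR → ℂ) (rv : iR → ℝ) (g : iA → iA → ℂ) (gv : iA → ℝ)
    (ρ : Matrix ((iA × iB1) × iB2) ((iA × iB1) × iB2) ℂ) :
    Matrix (iR × ((iA × iB1) × iB2)) (iR × ((iA × iB1) × iB2)) ℂ :=
  ∑ k, (p k : ℂ) • (proj (rb k) ⊗ₖ (UA3 g gv (rv k) * ρ * (UA3 g gv (rv k))ᴴ))

/-- `ω_{AB₁B₂} = Σ_l (|g_l⟩⟨g_l|⊗I) ρ (|g_l⟩⟨g_l|⊗I)`. -/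
def omega3 
    (g : iA → iA → ℂ)
    (ρ : Matrix ((iA × iB1) × iB2) ((iA × iB1) × iB2) ℂ) :
    Matrix ((iA × iB1) × iB2) ((iA × iB1) × iB2) ℂ :=
  ∑ l, ((proj (g l) ⊗ₖ (1 : Matrix iB1 iB1 ℂ)) ⊗ₖ (1 : Matrix iB2 iB2 ℂ)) * ρ *
       ((proj (g l) ⊗ₖ (1 : Matrix iB1 iB1 ℂ)) ⊗ₖ (1 : Matrix iB2 iB2 ℂ))

/-- Reduced state on `RAB₁` of a state on `RAB₁B₂`. -/
def redRAB1 
    (τ : Matrix (iR × ((iA × iB1) × iB2)) (iR × ((iA × iB1) × iB2)) ℂ) :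
    Matrix (iR × (iA × iB1)) (iR × (iA × iB1)) ℂ :=
  Matrix.of fun x y => ∑ k : iB2, τ (x.1, (x.2, k)) (y.1, (y.2, k))

/-- Reduced state on `AB₁` of a state on `RAB₁B₂`. -/
def redAB1four 
    (τ : Matrix (iR × ((iA × iB1) × iB2)) (iR × ((iA × iB1) × iB2)) ℂ) :
    Matrix (iA × iB1) (iA × iB1) ℂ :=
  Matrix.of fun x y => ∑ k : iR, ∑ m : iB2, τ (k, (x, m)) (k, (y, m))

/-- Reduced state on `R` of a state on `RAB₁B₂`. -/
def redRfour 
    (τ : Matrix (iR × ((iA × iB1) × iB2)) (iR × ((iA × iB1) × iB2)) ℂ) :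
    Matrix iR iR ℂ :=
  Matrix.of fun i j => ∑ x : (iA × iB1) × iB2, τ (i, x) (j, x)

/-- Reduced state on `AB₁` of a state on `AB₁B₂`. -/
def redAB1 
    (σ : Matrix ((iA × iB1) × iB2) ((iA × iB1) × iB2) ℂ) :
    Matrix (iA × iB1) (iA × iB1) ℂ :=
  Matrix.of fun x y => ∑ k : iB2, σ (x, k) (y, k)

/-- Reduced state on `AB₂` of a state on `AB₁B₂`. -/
def redAB2 
    (σ : Matrix ((iA × iB1) × iB2) ((iA × iB1) × iB2) ℂ) :
    Matrix (iA × iB2) (iA × iB2) ℂ :=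
  Matrix.of fun x y => ∑ m : iB1, σ ((x.1, m), x.2) ((y.1, m), y.2)

/-- Reduced state on `B₂` of a state on `AB₁B₂`. -/
def redB2 
    (σ : Matrix ((iA × iB1) × iB2) ((iA × iB1) × iB2) ℂ) :
    Matrix iB2 iB2 ℂ :=
  Matrix.of fun i j => ∑ x : iA × iB1, σ (x, i) (x, j)

/-- Reduced state on `A` of a state on `AB₁B₂`. -/
def redA3 
    (σ : Matrix ((iA × iB1) × iB2) ((iA × iB1) × iB2) ℂ) :
    Matrix iA iA ℂ :=
  Matrix.of fun i j => ∑ m : iB1, ∑ k : iB2, σ ((i, m), k) ((j, m), k)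

/-- Reduced state on `B₁` of a state on `AB₁B₂`. -/
def redB1 
    (σ : Matrix ((iA × iB1) × iB2) ((iA × iB1) × iB2) ℂ) :
    Matrix iB1 iB1 ℂ :=
  Matrix.of fun i j => ∑ a : iA, ∑ k : iB2, σ ((a, i), k) ((a, j), k)

/-- Reduced state on `B₁B₂` of a state on `AB₁B₂`. -/
def redB1B2 
    (σ : Matrix ((iA × iB1) × iB2) ((iA × iB1) × iB2) ℂ) :
    Matrix (iB1 × iB2) (iB1 × iB2) ℂ :=
  Matrix.of fun x y => ∑ a : iA, σ ((a, x.1), x.2) ((a, y.1), y.2)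

end Tripartite


lemma aux_vN_eq {n : Type*} [Fintype n] [DecidableEq n] {A : Matrix n n ℂ} (hA : A.IsHermitian) :
    vN A = ∑ i, Real.negMulLog (hA.eigenvalues i) := by
  have key : A * mlog A = (hA.eigenvectorUnitary : Matrix n n ℂ) *
      (Matrix.diagonal (fun i => (hA.eigenvalues i : ℂ)) *
      Matrix.diagonal (fun i => (Real.log (hA.eigenvalues i) : ℂ))) *
      (hA.eigenvectorUnitary : Matrix n n ℂ)ᴴ := by
    have h1 : A = (hA.eigenvectorUnitary : Matrix n n ℂ) *
      Matrix.diagonal (fun i => (hA.eigenvalues i : ℂ)) *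
      (hA.eigenvectorUnitary : Matrix n n ℂ)ᴴ := by
      have := hA.spectral_theorem
      rw [Unitary.conjStarAlgAut_apply] at this
      exact this
    have h2 : (hA.eigenvectorUnitary : Matrix n n ℂ)ᴴ * (hA.eigenvectorUnitary : Matrix n n ℂ) = 1 :=
      Unitary.coe_star_mul_self hA.eigenvectorUnitary
    unfold mlog
    rw [dif_pos hA]
    conv_lhs => enter [1]; rw [h1]
    simp only [Matrix.mul_assoc]
    rw [← Matrix.mul_assoc _ᴴ (hA.eigenvectorUnitary : Matrix n n ℂ), h2, Matrix.one_mul]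
  have h2 : (hA.eigenvectorUnitary : Matrix n n ℂ)ᴴ * (hA.eigenvectorUnitary : Matrix n n ℂ) = 1 :=
    Unitary.coe_star_mul_self hA.eigenvectorUnitary
  unfold vN
  rw [key, Matrix.trace_mul_comm, ← Matrix.mul_assoc, h2, Matrix.one_mul,
    Matrix.diagonal_mul_diagonal, Matrix.trace_diagonal, Complex.re_sum, ← Finset.sum_neg_distrib]
  refine Finset.sum_congr rfl fun i _ => ?_
  rw [← Complex.ofReal_mul, Complex.ofReal_re, Real.negMulLog]
  ring

lemma aux_vN_of_diag {n : Type*} [Fintype n] [DecidableEq n] {A W : Matrix n n ℂ} {d : n → ℝ}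
    (hW : Wᴴ * W = 1) (hA : A * W = W * Matrix.diagonal (fun i => (d i : ℂ))) :
    vN A = ∑ i, Real.negMulLog (d i) := by
  have hW' : W * Wᴴ = 1 := mul_eq_one_comm.mp hW
  have hA' : A = W * Matrix.diagonal (fun i => (d i : ℂ)) * Wᴴ := by
    rw [← hA, Matrix.mul_assoc, hW', Matrix.mul_one]
  have hH : A.IsHermitian := by
    rw [hA', Matrix.IsHermitian, Matrix.conjTranspose_mul, Matrix.conjTranspose_mul,
      Matrix.conjTranspose_conjTranspose, Matrix.diagonal_conjTranspose, Matrix.mul_assoc]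
    congr 3
    ext i
    simp
  have hc : A.charpoly = ∏ i, (Polynomial.X - Polynomial.C (d i : ℂ)) := by
    rw [hA', Matrix.charpoly_mul_comm, ← Matrix.mul_assoc, hW, Matrix.one_mul,
      Matrix.charpoly_diagonal]
  have hr : A.charpoly.roots = Multiset.map (fun i => (d i : ℂ)) Finset.univ.val := by
    rw [hc, Polynomial.roots_prod]
    · simp
    · simp [Finset.prod_ne_zero_iff, Polynomial.X_sub_C_ne_zero]
  have := hH.roots_charpoly_eq_eigenvalues
  rw [hr] at this
  have h3 := congrArg (fun s => (Multiset.map (fun z : ℂ => Real.negMulLog z.re) s).sum) this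
  simp only [Multiset.map_map, Function.comp_def] at h3
  rw [aux_vN_eq hH]
  exact h3.symm

lemma aux_subadd {n : Type*} [Fintype n] (x : n → ℝ) (hx : ∀ i, 0 ≤ x i) :
    Real.negMulLog (∑ i, x i) ≤ ∑ i, Real.negMulLog (x i) := by
  unfold Real.negMulLog
  rw [neg_mul, Finset.sum_mul, ← Finset.sum_neg_distrib]
  refine Finset.sum_le_sum fun i _ => ?_
  rcases (hx i).eq_or_lt with h | h
  · simp [← h]
  · have : Real.log (x i) ≤ Real.log (∑ i, x i) :=
      Real.log_le_log h (Finset.single_le_sum (fun j _ => hx j) (Finset.mem_univ i))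
    nlinarith

lemma aux_vN_nonneg {n : Type*} [Fintype n] [DecidableEq n] {A : Matrix n n ℂ} (hA : A.PosSemidef)
    (ht : A.trace = 1) : 0 ≤ vN A := by
  rw [aux_vN_eq hA.1]
  have h := hA.1.trace_eq_sum_eigenvalues
  rw [ht] at h
  have h' : ∑ i, hA.1.eigenvalues i = 1 := by
    have := congrArg Complex.re h
    simpa using this.symm
  have := aux_subadd _ hA.eigenvalues_nonneg
  rw [h'] at this
  simpa using this

lemma aux_vN_pure {n : Type*} [Fintype n] [DecidableEq n] {A : Matrix n n ℂ} (hA : A.IsHermitian)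
    (h2 : A * A = A) : vN A = 0 := by
  rw [aux_vN_eq hA]
  refine Finset.sum_eq_zero fun i _ => ?_
  have h := hA.mulVec_eigenvectorBasis i
  have hne : (⇑(hA.eigenvectorBasis i) : n → ℂ) ≠ 0 := by
    intro h0
    apply hA.eigenvectorBasis.orthonormal.ne_zero i
    ext j
    exact congrFun h0 j
  have h3 := congrArg (fun v => A *ᵥ v) h
  beta_reduce at h3
  rw [Matrix.mulVec_mulVec, h2, Matrix.mulVec_smul, h] at h3
  rw [smul_smul] at h3
  have h4 := smul_left_injective ℝ hne h3
  have : hA.eigenvalues i = 0 ∨ hA.eigenvalues i = 1 := by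
    have : hA.eigenvalues i * (hA.eigenvalues i - 1) = 0 := by linarith
    rcases mul_eq_zero.mp this with h | h
    · exact Or.inl h
    · right; linarith
  rcases this with h | h <;> simp [h]

lemma aux_cond {iA iB : Type*} [Fintype iA] [Fintype iB] [DecidableEq iA] [DecidableEq iB]
    (g : iA → iA → ℂ) (hg : ∀ l m, ∑ a, star (g l a) * g m a = if l = m then 1 else 0)
    (τ : iA → Matrix iB iB ℂ) (hτ : ∀ l, (τ l).PosSemidef)
    (R : Matrix (iA × iB) (iA × iB) ℂ) (Q : Matrix iA iA ℂ)
    (hR : ∀ x y, R x y = ∑ l, g l x.1 * star (g l y.1) * τ l x.2 y.2)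
    (hQ : ∀ x y, Q x y = ∑ l, g l x * star (g l y) * (τ l).trace) :
    vN Q ≤ vN R := by
  have hQv : vN Q = ∑ l, Real.negMulLog (∑ j, (hτ l).1.eigenvalues j) := by
    refine aux_vN_of_diag (W := Matrix.of fun a l => g l a) ?_ ?_
    · ext l m
      simp [Matrix.mul_apply, Matrix.one_apply, ← hg]
    · ext a l
      rw [Matrix.mul_diagonal]
      simp only [Matrix.mul_apply, hQ, Matrix.of_apply, Finset.sum_mul]
      rw [Finset.sum_comm]
      have : ∀ m, ∑ a', g m a * star (g m a') * (τ m).trace * g l a' =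
          g m a * (τ m).trace * (if m = l then 1 else 0) := by
        intro m
        rw [← hg, Finset.mul_sum]
        exact Finset.sum_congr rfl fun _ _ => by ring
      simp only [this]
      simp [(hτ l).1.trace_eq_sum_eigenvalues]
  have hRv : vN R = ∑ x : iA × iB, Real.negMulLog ((hτ x.1).1.eigenvalues x.2) := by
    refine aux_vN_of_diag (W := Matrix.of fun x y =>
      g y.1 x.1 * ((hτ y.1).1.eigenvectorUnitary : Matrix iB iB ℂ) x.2 y.2) ?_ ?_
    · ext ⟨l, j⟩ ⟨m, k⟩
      simp only [Matrix.mul_apply, Matrix.conjTranspose_apply, Matrix.of_apply, star_mul',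
        Fintype.sum_prod_type]
      have : ∀ V W : iB → ℂ, ∑ a, ∑ b, (star (g l a) * V b) * (g m a * W b) =
          (if l = m then 1 else 0) * ∑ b, V b * W b := by
        intro V W
        rw [← hg, Finset.sum_mul_sum]
        exact Finset.sum_congr rfl fun _ _ => Finset.sum_congr rfl fun _ _ => by ring
      rw [this]
      by_cases hlm : l = m
      · subst hlm
        have h2 : ((hτ l).1.eigenvectorUnitary : Matrix iB iB ℂ)ᴴ *
          ((hτ l).1.eigenvectorUnitary : Matrix iB iB ℂ) = 1 :=
          Unitary.coe_star_mul_self (hτ l).1.eigenvectorUnitary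
        have h3 := congrFun (congrFun h2 j) k
        rw [Matrix.mul_apply] at h3
        simp only [Matrix.conjTranspose_apply] at h3
        rw [h3]
        simp [Matrix.one_apply]
      · simp [hlm, Matrix.one_apply]
    · ext ⟨a, b⟩ ⟨l, j⟩
      rw [Matrix.mul_diagonal]
      simp only [Matrix.mul_apply, hR, Matrix.of_apply, Fintype.sum_prod_type, Finset.sum_mul]
      have h1 : ∀ V : iB → ℂ, ∑ a', ∑ b', ∑ m, g m a * star (g m a') * τ m b b' * (g l a' * V b')
          = g l a * ∑ b', τ l b b' * V b' := by
        intro V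
        have : ∀ m, ∑ a', ∑ b', g m a * star (g m a') * τ m b b' * (g l a' * V b') =
            (if m = l then 1 else 0) * (g m a * ∑ b', τ m b b' * V b') := by
          intro m
          rw [← hg, Finset.mul_sum, Finset.sum_mul_sum]
          exact Finset.sum_congr rfl fun _ _ => Finset.sum_congr rfl fun _ _ => by ring
        calc _ = ∑ a', ∑ m, ∑ b', g m a * star (g m a') * τ m b b' * (g l a' * V b') :=
              Finset.sum_congr rfl fun _ _ => Finset.sum_comm
          _ = ∑ m, ∑ a', ∑ b', g m a * star (g m a') * τ m b b' * (g l a' * V b') :=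
              Finset.sum_comm
          _ = _ := by
              simp only [this]
              simp
      rw [h1]
      have h2 := congrFun ((hτ l).1.mulVec_eigenvectorBasis j) b
      simp only [Matrix.mulVec, dotProduct, Pi.smul_apply, Complex.real_smul] at h2
      simp only [Matrix.IsHermitian.eigenvectorUnitary_apply]
      rw [h2]
      ring
  rw [hQv, hRv, Fintype.sum_prod_type]
  exact Finset.sum_le_sum fun l _ => aux_subadd _ (hτ l).eigenvalues_nonneg

lemma aux_proj_conj {α : Type*} [Fintype α] (P : Matrix α α ℂ) (hP : Pᴴ = P) (ψ : α → ℂ) :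
    P * proj ψ * P = proj (P *ᵥ ψ) := by
  unfold proj
  rw [Matrix.mul_vecMulVec, Matrix.vecMulVec_mul, Matrix.star_mulVec, hP]

section
variable {iA iB1 iB2 : Type*} [Fintype iA] [Fintype iB1] [Fintype iB2]
    [DecidableEq iA] [DecidableEq iB1] [DecidableEq iB2]

/-- Component of `ψ` along `g l`. -/
def auxPhi (g : iA → iA → ℂ) (ψ : ((iA × iB1) × iB2) → ℂ) (l : iA) : Matrix iB1 iB2 ℂ :=
  Matrix.of fun b k => ∑ c, star (g l c) * ψ ((c, b), k)

lemma aux_omega (g : iA → iA → ℂ) (ψ : ((iA × iB1) × iB2) → ℂ) (x y) :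
    omega3 g (proj ψ) x y = ∑ l, g l x.1.1 * star (g l y.1.1) *
      (auxPhi g ψ l x.1.2 x.2 * star (auxPhi g ψ l y.1.2 y.2)) := by
  unfold omega3
  rw [Matrix.sum_apply]
  refine Finset.sum_congr rfl fun l _ => ?_
  have hv : ∀ z, ((proj (g l) ⊗ₖ (1 : Matrix iB1 iB1 ℂ)) ⊗ₖ (1 : Matrix iB2 iB2 ℂ) *ᵥ ψ) z =
      g l z.1.1 * auxPhi g ψ l z.1.2 z.2 := by
    rintro ⟨⟨a, b⟩, k⟩
    simp [Matrix.mulVec, dotProduct, Fintype.sum_prod_type, Matrix.one_apply, auxPhi, proj,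
      Matrix.vecMulVec_apply, Finset.mul_sum, mul_assoc]
  have hp : (proj (g l))ᴴ = proj (g l) := by
    simp [proj, Matrix.conjTranspose_vecMulVec]
  rw [aux_proj_conj]
  · rw [proj, Matrix.vecMulVec_apply, Pi.star_apply, hv, hv, star_mul']
    ring
  · rw [Matrix.conjTranspose_kronecker, Matrix.conjTranspose_kronecker, hp]
    simp

lemma aux_trA (g : iA → iA → ℂ) (hg : ∀ l m, ∑ a, star (g l a) * g m a = if l = m then 1 else 0)
    (hgc : ∀ a a', ∑ l, g l a * star (g l a') = if a = a' then 1 else 0)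
    (ψ : ((iA × iB1) × iB2) → ℂ) (b b' k k') :
    ∑ a, omega3 g (proj ψ) ((a, b), k) ((a, b'), k') = ∑ a, proj ψ ((a, b), k) ((a, b'), k') := by
  simp only [aux_omega]
  rw [Finset.sum_comm]
  have h1 : ∀ l, ∑ a, g l a * star (g l a) *
      (auxPhi g ψ l b k * star (auxPhi g ψ l b' k')) =
      ∑ c, ∑ c', ψ ((c, b), k) * star (ψ ((c', b'), k')) * (g l c' * star (g l c)) := by
    intro l
    rw [← Finset.sum_mul]
    have := hg l l
    simp only [if_true] at this
    simp only [mul_comm (g l _) (star (g l _))]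
    rw [this, one_mul]
    simp only [auxPhi, Matrix.of_apply, star_sum, star_mul', star_star]
    rw [Finset.sum_mul_sum]
    exact Finset.sum_congr rfl fun _ _ => Finset.sum_congr rfl fun _ _ => by ring
  simp only [h1]
  rw [Finset.sum_comm]
  refine Finset.sum_congr rfl fun c _ => ?_
  rw [Finset.sum_comm]
  simp only [← Finset.mul_sum, hgc]
  simp [proj, Matrix.vecMulVec_apply]

end

/-- **The extra term vanishes for pure states**: if `ρ_{AB₁B₂}` is pure, then
`I(A:B₁)_ω − I(B₁:B₂)_ρ + S(A|B₁B₂)_ρ = −S(B₁|A)_ω − S(B₂)_ω ≤ 0`,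
and `S(B₁|A)_ω ≥ 0` since `ω_{AB₁}` is classical on `A`. -/
theorem tripartite_extra_term_nonpos_of_pure
    {iA iB1 iB2 : Type*} [Fintype iA] [Fintype iB1] [Fintype iB2]
    [DecidableEq iA] [DecidableEq iB1] [DecidableEq iB2]
    (ρ : Matrix ((iA × iB1) × iB2) ((iA × iB1) × iB2) ℂ)
    (hρ : ρ.PosSemidef) (hρtr : ρ.trace = 1)
    (hpure : ∃ ψ : ((iA × iB1) × iB2) → ℂ, star ψ ⬝ᵥ ψ = 1 ∧ ρ = proj ψ)
    (g : iA → iA → ℂ)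
    (hg : ∀ l m, star (g l) ⬝ᵥ g m = if l = m then 1 else 0)
    (hgc : ∑ l, proj (g l) = (1 : Matrix iA iA ℂ)) :
    ((vN (redA3 (omega3 g ρ)) + vN (redB1 (omega3 g ρ)) - vN (redAB1 (omega3 g ρ)))
        - (vN (redB1 ρ) + vN (redB2 ρ) - vN (redB1B2 ρ))
        + (vN ρ - vN (redB1B2 ρ))
      = -(vN (redAB1 (omega3 g ρ)) - vN (redA3 (omega3 g ρ))) - vN (redB2 (omega3 g ρ)))
    ∧ vN (redAB1 (omega3 g ρ)) - vN (redA3 (omega3 g ρ)) ≥ 0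
    ∧ ((vN (redA3 (omega3 g ρ)) + vN (redB1 (omega3 g ρ)) - vN (redAB1 (omega3 g ρ)))
        - (vN (redB1 ρ) + vN (redB2 ρ) - vN (redB1B2 ρ))
        + (vN ρ - vN (redB1B2 ρ)) ≤ 0) := by
  have hg' : ∀ l m, ∑ a, star (g l a) * g m a = if l = m then 1 else 0 := hg
  have hgc' : ∀ a a', ∑ l, g l a * star (g l a') = if a = a' then 1 else 0 := by
    intro a a'
    have := congrFun (congrFun hgc a) a'
    rw [Matrix.sum_apply] at this
    simpa [proj, Matrix.vecMulVec_apply, Matrix.one_apply] using this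
  obtain ⟨ψ, hψ, rfl⟩ := hpure
  have e1 : redB1 (omega3 g (proj ψ)) = redB1 (proj ψ) := by
    ext i j
    simp only [redB1, Matrix.of_apply]
    rw [Finset.sum_comm, Finset.sum_comm (s := (Finset.univ : Finset iA))]
    exact Finset.sum_congr rfl fun k _ => aux_trA g hg' hgc' ψ i j k k
  have e2 : redB2 (omega3 g (proj ψ)) = redB2 (proj ψ) := by
    ext i j
    simp only [redB2, Matrix.of_apply, Fintype.sum_prod_type]
    rw [Finset.sum_comm, Finset.sum_comm (s := (Finset.univ : Finset iA))]
    exact Finset.sum_congr rfl fun b _ => aux_trA g hg' hgc' ψ b b i j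
  have e3 : vN (proj ψ) = 0 := by
    refine aux_vN_pure hρ.1 ?_
    unfold proj
    rw [Matrix.vecMulVec_mul_vecMulVec, hψ]
    simp
  have e4 : 0 ≤ vN (redB2 (proj ψ)) := by
    refine aux_vN_nonneg ?_ ?_
    · have : redB2 (proj ψ) = (Matrix.of fun i x => ψ (x, i)) *
          (Matrix.of fun i x => ψ (x, i))ᴴ := by
        ext i j
        simp [redB2, proj, Matrix.mul_apply, Matrix.vecMulVec_apply]
      rw [this]
      exact Matrix.posSemidef_self_mul_conjTranspose _
    · rw [← hρtr]
      simp only [Matrix.trace, Matrix.diag_apply, redB2, Matrix.of_apply]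
      rw [Fintype.sum_prod_type, Finset.sum_comm]
  have e5 : vN (redA3 (omega3 g (proj ψ))) ≤ vN (redAB1 (omega3 g (proj ψ))) := by
    refine aux_cond g hg' (fun l => auxPhi g ψ l * (auxPhi g ψ l)ᴴ)
      (fun l => Matrix.posSemidef_self_mul_conjTranspose _) _ _ ?_ ?_
    · intro x y
      simp only [redAB1, Matrix.of_apply, aux_omega, Matrix.mul_apply,
        Matrix.conjTranspose_apply, Finset.mul_sum]
      rw [Finset.sum_comm]
    · intro x y
      simp only [redA3, Matrix.of_apply, aux_omega, Matrix.mul_apply, Matrix.trace,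
        Matrix.diag_apply, Matrix.conjTranspose_apply, Finset.mul_sum]
      exact (Finset.sum_congr rfl fun _ _ => Finset.sum_comm).trans Finset.sum_comm
  rw [e1, e2, e3]
  refine ⟨by ring, by linarith, by linarith⟩
end
end

section
/- (Commuting-square entropic uncertainty relation.) Let M be the algebra of operators on a finite-dimensional Hilbert space, and let E_N, E_T, E_R be conditional expectations onto *-subalgebras N, T, R of M (each E_X is unital, completely positive, trace-preserving, idempotent with image X, and satisfies Tr(σ E_X(ρ)) = Tr(σρ) for all σ ∈ X and all ρ). If E_N ∘ E_T = E_T ∘ E_N = E_R (a commuting square), then for every density operator ρ, S(E_N(ρ)) + S(E_T(ρ)) ≥ S(ρ) + S(E_R(ρ)). -/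
open scoped Kronecker Classical ComplexOrder
open Matrix

noncomputable section

/-- `E` is a conditional expectation onto the star-subalgebra `X` of the matrix algebra:
it is unital, trace-preserving, completely positive (`id_n ⊗ E` preserves positive
semidefiniteness, applied blockwise), idempotent with image `X`, and satisfies
`Tr(σ E(ρ)) = Tr(σρ)` for all `σ ∈ X`. -/
structure IsCondExp {n : Type*} [Fintype n] [DecidableEq n]
    (E : Matrix n n ℂ →ₗ[ℂ] Matrix n n ℂ) (X : StarSubalgebra ℂ (Matrix n n ℂ)) : Prop where
  unital : E 1 = 1
  trace_preserving : ∀ ρ : Matrix n n ℂ, (E ρ).trace = ρ.trace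
  completely_positive : ∀ m : ℕ, ∀ M : Matrix (Fin m × n) (Fin m × n) ℂ, M.PosSemidef →
    (Matrix.of fun p q =>
      E (Matrix.of fun a b => M (p.1, a) (q.1, b)) p.2 q.2 :
        Matrix (Fin m × n) (Fin m × n) ℂ).PosSemidef
  mem_image : ∀ ρ : Matrix n n ℂ, E ρ ∈ X
  fixes : ∀ σ ∈ X, E σ = σ
  trace_cond : ∀ σ ∈ X, ∀ ρ : Matrix n n ℂ, (σ * E ρ).trace = (σ * ρ).trace

open Filter Topology

namespace CSQ

variable {n : Type*} [Fintype n] [DecidableEq n]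

/-- diagonalisation data -/
structure Diag (A U : Matrix n n ℂ) (d : n → ℝ) : Prop where
  l : Uᴴ * U = 1
  r : U * Uᴴ = 1
  eq : A = U * Matrix.diagonal (fun i => (d i : ℂ)) * Uᴴ

lemma Diag.of_herm {A : Matrix n n ℂ} (h : A.IsHermitian) :
    Diag A (h.eigenvectorUnitary : Matrix n n ℂ) h.eigenvalues := by
  refine ⟨?_, ?_, ?_⟩
  · have := Unitary.coe_star_mul_self h.eigenvectorUnitary
    simpa [Matrix.star_eq_conjTranspose] using this
  · have := Unitary.coe_mul_star_self h.eigenvectorUnitary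
    simpa [Matrix.star_eq_conjTranspose] using this
  · have := h.spectral_theorem
    rw [Unitary.conjStarAlgAut_apply] at this
    simpa [Matrix.star_eq_conjTranspose, Function.comp_def] using this

lemma Diag.func {A U V : Matrix n n ℂ} {d e : n → ℝ} (h1 : Diag A U d) (h2 : Diag A V e)
    (f : ℝ → ℝ) :
    U * Matrix.diagonal (fun i => (f (d i) : ℂ)) * Uᴴ =
      V * Matrix.diagonal (fun i => (f (e i) : ℂ)) * Vᴴ := by
  have key : ∀ g : ℝ → ℝ, (Vᴴ * U) * Matrix.diagonal (fun i => (g (d i) : ℂ)) =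
      Matrix.diagonal (fun i => (g (e i) : ℂ)) * (Vᴴ * U) ↔
      U * Matrix.diagonal (fun i => (g (d i) : ℂ)) * Uᴴ =
      V * Matrix.diagonal (fun i => (g (e i) : ℂ)) * Vᴴ := by
    intro g
    constructor
    · intro h
      calc U * Matrix.diagonal (fun i => (g (d i) : ℂ)) * Uᴴ
          = V * ((Vᴴ * U) * Matrix.diagonal (fun i => (g (d i) : ℂ))) * Uᴴ := by
            rw [← Matrix.mul_assoc, ← Matrix.mul_assoc, h2.r, Matrix.one_mul]
        _ = V * Matrix.diagonal (fun i => (g (e i) : ℂ)) * Vᴴ * (U * Uᴴ) := by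
            rw [h]; simp only [Matrix.mul_assoc]
        _ = _ := by rw [h1.r, Matrix.mul_one]
    · intro h
      calc (Vᴴ * U) * Matrix.diagonal (fun i => (g (d i) : ℂ))
          = Vᴴ * (U * Matrix.diagonal (fun i => (g (d i) : ℂ)) * Uᴴ) * U := by
            simp only [Matrix.mul_assoc, h1.l, Matrix.mul_one]
        _ = (Vᴴ * V) * Matrix.diagonal (fun i => (g (e i) : ℂ)) * (Vᴴ * U) := by
            rw [h]; simp only [Matrix.mul_assoc]
        _ = _ := by rw [h2.l, Matrix.one_mul]
  rw [← key f]
  have h0 := (key id).2 (by simpa using h1.eq.symm.trans h2.eq)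
  ext j i
  have := congrFun (congrFun h0 j) i
  rw [Matrix.mul_diagonal, Matrix.diagonal_mul] at this ⊢
  by_cases hw : (Vᴴ * U) j i = 0
  · rw [hw]; simp
  · have : d i = e j := by
      rw [mul_comm] at this
      exact_mod_cast mul_right_cancel₀ hw this
    rw [this, mul_comm]

lemma Diag.isHermitian {A U : Matrix n n ℂ} {d : n → ℝ} (h : Diag A U d) : A.IsHermitian := by
  rw [h.eq]
  apply Matrix.isHermitian_mul_mul_conjTranspose
  rw [Matrix.isHermitian_diagonal_iff]
  intro i
  simp [isSelfAdjoint_iff]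

lemma Diag.mlog {A U : Matrix n n ℂ} {d : n → ℝ} (h : Diag A U d) :
    mlog A = U * Matrix.diagonal (fun i => (Real.log (d i) : ℂ)) * Uᴴ := by
  have hh := h.isHermitian
  unfold _root_.mlog
  rw [dif_pos hh]
  exact (Diag.of_herm hh).func h Real.log

lemma Diag.pow {A U : Matrix n n ℂ} {d : n → ℝ} (h : Diag A U d) (k : ℕ) :
    A ^ k = U * Matrix.diagonal (fun i => ((d i) ^ k : ℂ)) * Uᴴ := by
  induction k with
  | zero => simp [h.r]
  | succ k ih =>
    rw [pow_succ, ih]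
    conv_lhs => rw [h.eq]
    calc _ = U * Matrix.diagonal (fun i => ((d i) ^ k : ℂ)) * (Uᴴ * U) *
          Matrix.diagonal (fun i => (d i : ℂ)) * Uᴴ := by simp only [Matrix.mul_assoc]
      _ = _ := by
        rw [h.l, Matrix.mul_one, Matrix.mul_assoc U, Matrix.diagonal_mul_diagonal]
        simp only [pow_succ]

lemma Diag.aeval {A U : Matrix n n ℂ} {d : n → ℝ} (h : Diag A U d) (P : Polynomial ℂ) :
    Polynomial.aeval A P = U * Matrix.diagonal (fun i => P.eval (d i : ℂ)) * Uᴴ := by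
  induction P using Polynomial.induction_on' with
  | add p q hp hq =>
    rw [map_add, hp, hq, ← Matrix.add_mul, ← Matrix.mul_add, Matrix.diagonal_add]
    simp
  | monomial k a =>
    rw [Polynomial.aeval_monomial, h.pow k, ← Algebra.smul_def]
    simp only [Polynomial.eval_monomial]
    rw [← Matrix.smul_mul, ← Matrix.mul_smul, ← Matrix.diagonal_smul]
    rfl

lemma mlog_mem {A : Matrix n n ℂ} (hA : A.IsHermitian) (X : StarSubalgebra ℂ (Matrix n n ℂ))
    (hX : A ∈ X) : mlog A ∈ X := by
  have h := Diag.of_herm hA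
  set d := hA.eigenvalues
  let s : Finset ℂ := Finset.univ.image (fun i => (d i : ℂ))
  let P := Lagrange.interpolate s id (fun z : ℂ => ((Real.log z.re : ℝ) : ℂ))
  have hP : ∀ i, P.eval (d i : ℂ) = ((Real.log (d i) : ℝ) : ℂ) := by
    intro i
    have := Lagrange.eval_interpolate_at_node (s := s) (v := id)
      (fun z : ℂ => ((Real.log z.re : ℝ) : ℂ)) (Set.injOn_id _)
      (i := (d i : ℂ)) (by simp [s])
    simpa [P] using this
  have : mlog A = Polynomial.aeval A P := by
    rw [h.mlog, h.aeval]; simp only [hP]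
  rw [this]
  rw [Polynomial.aeval_eq_sum_range]
  exact sum_mem fun k _ => SMulMemClass.smul_mem _ (pow_mem hX k)

lemma trace_diag (U V : Matrix n n ℂ) (p f : n → ℝ) :
    ((U * Matrix.diagonal (fun i => (p i : ℂ)) * Uᴴ) *
      (V * Matrix.diagonal (fun i => (f i : ℂ)) * Vᴴ)).trace.re =
    ∑ i, ∑ j, Complex.normSq ((Vᴴ * U) j i) * (p i * f j) := by
  have : ((U * Matrix.diagonal (fun i => (p i : ℂ)) * Uᴴ) *
      (V * Matrix.diagonal (fun i => (f i : ℂ)) * Vᴴ)).trace =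
      (Matrix.diagonal (fun i => (p i : ℂ)) * ((Vᴴ * U)ᴴ *
        (Matrix.diagonal (fun i => (f i : ℂ)) * (Vᴴ * U)))).trace := by
    rw [Matrix.mul_assoc U, Matrix.mul_assoc U, Matrix.trace_mul_comm U]
    congr 1
    simp only [Matrix.conjTranspose_mul, Matrix.conjTranspose_conjTranspose, Matrix.mul_assoc]
  rw [this]
  simp only [Matrix.trace, Matrix.diag_apply, Matrix.diagonal_mul]
  rw [Complex.re_sum]
  refine Finset.sum_congr rfl fun i _ => ?_
  rw [Matrix.mul_apply, Finset.mul_sum, Complex.re_sum]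
  refine Finset.sum_congr rfl fun j _ => ?_
  rw [Matrix.diagonal_mul, Matrix.conjTranspose_apply]
  simp [Complex.normSq_apply]
  ring

lemma sum_w {U V : Matrix n n ℂ} (hU : Uᴴ * U = 1) (hV : V * Vᴴ = 1) (i : n) :
    ∑ j, Complex.normSq ((Vᴴ * U) j i) = 1 := by
  have : (Vᴴ * U)ᴴ * (Vᴴ * U) = 1 := by
    rw [Matrix.conjTranspose_mul, Matrix.conjTranspose_conjTranspose, Matrix.mul_assoc,
      ← Matrix.mul_assoc V, hV, Matrix.one_mul, hU]
  have := congrFun (congrFun this i) i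
  rw [Matrix.mul_apply, Matrix.one_apply_eq] at this
  have := congrArg Complex.re this
  rw [Complex.re_sum] at this
  simpa [Complex.normSq_apply, Matrix.conjTranspose_apply] using this

lemma Diag.vN_eq {A U : Matrix n n ℂ} {d : n → ℝ} (h : Diag A U d) :
    vN A = ∑ i, Real.negMulLog (d i) := by
  unfold vN
  rw [h.mlog]
  conv_lhs => rw [h.eq]
  have : (U * Matrix.diagonal (fun i => (d i : ℂ)) * Uᴴ *
      (U * Matrix.diagonal (fun i => (Real.log (d i) : ℂ)) * Uᴴ)).trace =
      ∑ i, ((d i * Real.log (d i) : ℝ) : ℂ) := by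
    calc _ = (U * Matrix.diagonal (fun i => (d i : ℂ)) * (Uᴴ * U) *
          Matrix.diagonal (fun i => (Real.log (d i) : ℂ)) * Uᴴ).trace := by
            simp only [Matrix.mul_assoc]
      _ = _ := by
        rw [h.l, Matrix.mul_one, Matrix.trace_mul_comm, Matrix.mul_assoc U, ← Matrix.mul_assoc,
          h.l, Matrix.one_mul, Matrix.diagonal_mul_diagonal, Matrix.trace_diagonal]
        simp
  rw [this, ← Complex.ofReal_sum, Complex.ofReal_re, ← Finset.sum_neg_distrib]
  simp [Real.negMulLog]

lemma relent_eq {A B U V : Matrix n n ℂ} {p q : n → ℝ} (hA : Diag A U p) (hB : Diag B V q) :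
    relent A B = ∑ i, ∑ j, Complex.normSq ((Vᴴ * U) j i) * (p i * (Real.log (p i) - Real.log (q j))) := by
  have h1 : relent A B = -vN A - (A * mlog B).trace.re := by
    simp [relent, vN, Matrix.mul_sub]
  rw [h1, hA.vN_eq, hB.mlog]
  conv_lhs => rw [hA.eq]
  rw [trace_diag, ← Finset.sum_neg_distrib, ← Finset.sum_sub_distrib]
  refine Finset.sum_congr rfl fun i _ => ?_
  have : -Real.negMulLog (p i) =
      ∑ j, Complex.normSq ((Vᴴ * U) j i) * (p i * Real.log (p i)) := by
    rw [← Finset.sum_mul, sum_w hA.l hB.r]; simp [Real.negMulLog]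
  rw [this, ← Finset.sum_sub_distrib]
  refine Finset.sum_congr rfl fun j _ => ?_
  ring

lemma Diag.trace_eq {A U V : Matrix n n ℂ} {p : n → ℝ} (hA : Diag A U p) (hV : V * Vᴴ = 1) :
    A.trace.re = ∑ i, ∑ j, Complex.normSq ((Vᴴ * U) j i) * p i := by
  conv_lhs => rw [hA.eq]
  rw [Matrix.trace_mul_comm, ← Matrix.mul_assoc, hA.l, Matrix.one_mul, Matrix.trace_diagonal,
    Complex.re_sum]
  refine Finset.sum_congr rfl fun i _ => ?_
  rw [← Finset.sum_mul, sum_w hA.l hV]; simp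

/-- variational functional -/
def Fn (t : ℝ) (A B Y : Matrix n n ℂ) : ℝ :=
  2 * (A * Y).trace.re - (B * (Y * Yᴴ)).trace.re - t * (A * (Yᴴ * Y)).trace.re

lemma diag_sum (d : n → ℝ) (Z : Matrix n n ℂ) :
    (Matrix.diagonal (fun i => (d i : ℂ)) * (Z * Zᴴ)).trace.re =
      ∑ i, ∑ j, d i * Complex.normSq (Z i j) := by
  simp only [Matrix.trace, Matrix.diag_apply, Matrix.diagonal_mul]
  rw [Complex.re_sum]
  refine Finset.sum_congr rfl fun i _ => ?_
  rw [Matrix.mul_apply, Finset.mul_sum, Complex.re_sum]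
  refine Finset.sum_congr rfl fun j _ => ?_
  simp [Complex.normSq_apply]

lemma Fn_eq {A B U V : Matrix n n ℂ} {p q : n → ℝ} (hA : Diag A U p) (hB : Diag B V q)
    (t : ℝ) (Z : Matrix n n ℂ) :
    Fn t A B (V * Z * Uᴴ) = ∑ i, ∑ j, (2 * p i * (star ((Vᴴ * U) j i) * Z j i).re
      - (q j + t * p i) * Complex.normSq (Z j i)) := by
  have e1 : (A * (V * Z * Uᴴ)).trace.re = ∑ i, ∑ j, p i * (star ((Vᴴ * U) j i) * Z j i).re := by
    have : (A * (V * Z * Uᴴ)).trace =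
        (Matrix.diagonal (fun i => (p i : ℂ)) * ((Vᴴ * U)ᴴ * Z)).trace := by
      conv_lhs => rw [hA.eq]
      rw [Matrix.mul_assoc U, Matrix.mul_assoc U, Matrix.trace_mul_comm U]
      congr 1
      simp only [Matrix.conjTranspose_mul, Matrix.conjTranspose_conjTranspose, Matrix.mul_assoc,
        hA.l, Matrix.mul_one]
    rw [this]
    simp only [Matrix.trace, Matrix.diag_apply, Matrix.diagonal_mul]
    rw [Complex.re_sum]
    refine Finset.sum_congr rfl fun i _ => ?_
    rw [Matrix.mul_apply, Finset.mul_sum, Complex.re_sum]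
    refine Finset.sum_congr rfl fun j _ => ?_
    rw [Matrix.conjTranspose_apply, Complex.re_ofReal_mul]
  have e2 : (B * ((V * Z * Uᴴ) * (V * Z * Uᴴ)ᴴ)).trace.re =
      ∑ j, ∑ i, q j * Complex.normSq (Z j i) := by
    rw [← diag_sum]
    congr 1
    conv_lhs => rw [hB.eq]
    rw [Matrix.mul_assoc V, Matrix.mul_assoc V, Matrix.trace_mul_comm V, Matrix.mul_assoc,
      Matrix.mul_assoc]
    congr 2
    calc _ = (Vᴴ * V) * Z * (Uᴴ * U) * Zᴴ * (Vᴴ * V) := by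
          simp only [Matrix.conjTranspose_mul, Matrix.conjTranspose_conjTranspose,
            Matrix.mul_assoc]
      _ = _ := by rw [hB.l, hA.l, Matrix.one_mul, Matrix.mul_one, Matrix.mul_one]
  have e3 : (A * ((V * Z * Uᴴ)ᴴ * (V * Z * Uᴴ))).trace.re =
      ∑ i, ∑ j, p i * Complex.normSq (Z j i) := by
    have := diag_sum p Zᴴ
    simp only [Matrix.conjTranspose_conjTranspose, Matrix.conjTranspose_apply,
      Complex.star_def, Complex.normSq_conj] at this
    rw [← this]
    congr 1
    conv_lhs => rw [hA.eq]
    rw [Matrix.mul_assoc U, Matrix.mul_assoc U, Matrix.trace_mul_comm U, Matrix.mul_assoc,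
      Matrix.mul_assoc]
    congr 2
    calc _ = (Uᴴ * U) * Zᴴ * (Vᴴ * V) * Z * (Uᴴ * U) := by
          simp only [Matrix.conjTranspose_mul, Matrix.conjTranspose_conjTranspose,
            Matrix.mul_assoc]
      _ = _ := by rw [hB.l, hA.l, Matrix.one_mul, Matrix.mul_one, Matrix.mul_one]
  rw [Finset.sum_comm] at e2
  unfold Fn
  rw [e1, e2, e3]
  simp only [Finset.mul_sum, ← Finset.sum_sub_distrib]
  refine Finset.sum_congr rfl fun i _ => Finset.sum_congr rfl fun j _ => ?_
  ring

lemma scal_le (p c : ℝ) (hc : 0 < c) (w z : ℂ) :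
    2 * p * (star w * z).re - c * Complex.normSq z ≤ Complex.normSq w * (p * p / c) := by
  rw [← mul_div_assoc, le_div_iff₀ hc]
  simp only [Complex.normSq_apply, Complex.star_def, Complex.mul_re, Complex.conj_re,
    Complex.conj_im]
  nlinarith [sq_nonneg (p * w.re - c * z.re), sq_nonneg (p * w.im - c * z.im)]

lemma scal_eq (p c : ℝ) (hc : 0 < c) (w : ℂ) :
    2 * p * (star w * (((p / c : ℝ) : ℂ) * w)).re - c * Complex.normSq (((p / c : ℝ) : ℂ) * w)
      = Complex.normSq w * (p * p / c) := by
  rw [mul_left_comm, Complex.re_ofReal_mul, Complex.normSq_mul, Complex.normSq_ofReal,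
    Complex.normSq_apply]
  simp only [Complex.star_def, Complex.mul_re, Complex.conj_re, Complex.conj_im]
  field_simp
  ring

lemma Fn_le {A B U V : Matrix n n ℂ} {p q : n → ℝ} (hA : Diag A U p) (hB : Diag B V q)
    (hp : ∀ i, 0 < p i) (hq : ∀ i, 0 < q i) (t : ℝ) (ht : 0 ≤ t) (Y : Matrix n n ℂ) :
    Fn t A B Y ≤ ∑ i, ∑ j, Complex.normSq ((Vᴴ * U) j i) * (p i * p i / (q j + t * p i)) := by
  have : Y = V * (Vᴴ * Y * U) * Uᴴ := by
    calc Y = (V * Vᴴ) * Y * (U * Uᴴ) := by rw [hA.r, hB.r, Matrix.one_mul, Matrix.mul_one]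
      _ = _ := by simp only [Matrix.mul_assoc]
  rw [this, Fn_eq hA hB]
  refine Finset.sum_le_sum fun i _ => Finset.sum_le_sum fun j _ => scal_le _ _ ?_ _ _
  have := hp i; have := hq j; positivity

lemma Fn_attained {A B U V : Matrix n n ℂ} {p q : n → ℝ} (hA : Diag A U p) (hB : Diag B V q)
    (hp : ∀ i, 0 < p i) (hq : ∀ i, 0 < q i) (t : ℝ) (ht : 0 ≤ t) :
    ∃ Y, Fn t A B Y =
      ∑ i, ∑ j, Complex.normSq ((Vᴴ * U) j i) * (p i * p i / (q j + t * p i)) := by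
  refine ⟨V * (Matrix.of fun j i => ((p i / (q j + t * p i) : ℝ) : ℂ) * (Vᴴ * U) j i) * Uᴴ, ?_⟩
  rw [Fn_eq hA hB]
  refine Finset.sum_congr rfl fun i _ => Finset.sum_congr rfl fun j _ => ?_
  have := hp i; have := hq j
  exact scal_eq _ _ (by positivity) _

section CE
variable {E : Matrix n n ℂ →ₗ[ℂ] Matrix n n ℂ} {X : StarSubalgebra ℂ (Matrix n n ℂ)}

lemma eq_of_trace (h : IsCondExp E X) {a b : Matrix n n ℂ} (ha : a ∈ X) (hb : b ∈ X)
    (hab : ∀ s ∈ X, (s * a).trace = (s * b).trace) : a = b := by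
  have hm : a - b ∈ X := sub_mem ha hb
  have := hab (star (a - b)) (star_mem hm)
  rw [← sub_eq_zero, ← Matrix.trace_sub, ← Matrix.mul_sub, Matrix.star_eq_conjTranspose,
    Matrix.trace_conjTranspose_mul_self_eq_zero_iff] at this
  exact sub_eq_zero.1 this

lemma bimod (h : IsCondExp E X) {a b : Matrix n n ℂ} (ha : a ∈ X) (hb : b ∈ X)
    (x : Matrix n n ℂ) : E (a * x * b) = a * E x * b := by
  refine eq_of_trace h (h.mem_image _) (mul_mem (mul_mem ha (h.mem_image _)) hb) fun s hs => ?_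
  rw [h.trace_cond s hs]
  have e : ∀ y : Matrix n n ℂ, (s * (a * y * b)).trace = ((b * s * a) * y).trace := by
    intro y
    rw [← Matrix.mul_assoc, Matrix.trace_mul_comm]
    simp only [Matrix.mul_assoc]
  rw [e, e, h.trace_cond _ (mul_mem (mul_mem hb hs) ha)]

lemma E_psd (h : IsCondExp E X) {A : Matrix n n ℂ} (hA : A.PosSemidef) : (E A).PosSemidef := by
  have := h.completely_positive 1 (A.submatrix Prod.snd Prod.snd) (hA.submatrix _)
  have := this.submatrix (fun i : n => ((0 : Fin 1), i))
  exact this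

lemma E_star (h : IsCondExp E X) (x : Matrix n n ℂ) : E (xᴴ) = (E x)ᴴ := by
  have hm : (E x)ᴴ ∈ X := by
    rw [← Matrix.star_eq_conjTranspose]; exact star_mem (h.mem_image x)
  refine eq_of_trace h (h.mem_image _) hm fun s hs => ?_
  rw [h.trace_cond s hs]
  have hs' : sᴴ ∈ X := by rw [← Matrix.star_eq_conjTranspose]; exact star_mem hs
  have e := congrArg star (h.trace_cond _ hs' x)
  rw [← Matrix.trace_conjTranspose, ← Matrix.trace_conjTranspose, Matrix.conjTranspose_mul,
    Matrix.conjTranspose_mul, Matrix.conjTranspose_conjTranspose, Matrix.trace_mul_comm,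
    Matrix.trace_mul_comm _ s] at e
  exact e.symm

lemma trace_E (h : IsCondExp E X) (a y : Matrix n n ℂ) :
    (E a * y).trace = (a * E y).trace := by
  rw [← h.trace_cond _ (h.mem_image a), Matrix.trace_mul_comm (E a), Matrix.trace_mul_comm a,
    h.trace_cond _ (h.mem_image y)]

/-- Kadison-Schwarz for conditional expectations, traced against a positive operator. -/
lemma schwarz (h : IsCondExp E X) {a : Matrix n n ℂ} (ha : a.PosSemidef) (y : Matrix n n ℂ) :
    (a * (E y * (E y)ᴴ)).trace.re ≤ (E a * (y * yᴴ)).trace.re := by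
  have hm := h.mem_image y
  have hm' : (E y)ᴴ ∈ X := by rw [← Matrix.star_eq_conjTranspose]; exact star_mem hm
  have e : E ((y - E y) * (y - E y)ᴴ) = E (y * yᴴ) - E y * (E y)ᴴ := by
    have h1 : E (E y * yᴴ) = E y * (E y)ᴴ := by
      have := bimod h hm (one_mem X) yᴴ
      simpa [E_star h] using this
    have h2 : E (y * (E y)ᴴ) = E y * (E y)ᴴ := by
      have := bimod h (one_mem X) hm' y
      simpa using this
    have h3 := h.fixes _ (mul_mem hm hm')
    rw [Matrix.conjTranspose_sub, Matrix.sub_mul, Matrix.mul_sub, Matrix.mul_sub]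
    simp only [map_sub, h1, h2, h3]
    abel
  have pos : 0 ≤ (E a * ((y - E y) * (y - E y)ᴴ)).trace := by
    have hp : ((y - E y)ᴴ * E a * (y - E y)).PosSemidef :=
      (E_psd h ha).conjTranspose_mul_mul_same _
    have := hp.trace_nonneg
    rwa [Matrix.mul_assoc, Matrix.trace_mul_comm, Matrix.mul_assoc] at this
  rw [trace_E h, e, Matrix.mul_sub, Matrix.trace_sub, ← trace_E h] at pos
  have := (Complex.le_def.1 pos).1
  simp at this
  linarith

lemma Fn_mono (h : IsCondExp E X) {a b : Matrix n n ℂ} (ha : a.PosSemidef) (hb : b.PosSemidef)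
    (t : ℝ) (ht : 0 ≤ t) (y : Matrix n n ℂ) :
    Fn t (E a) (E b) y ≤ Fn t a b (E y) := by
  have h1 := schwarz h hb y
  have h2 := schwarz h ha yᴴ
  rw [E_star h, Matrix.conjTranspose_conjTranspose, Matrix.conjTranspose_conjTranspose] at h2
  unfold Fn
  rw [trace_E h a y]
  have := mul_le_mul_of_nonneg_left h2 ht
  linarith

end CE

/-- Integrated functional. -/
def G (w : n → n → ℝ) (p q : n → ℝ) (t : ℝ) : ℝ :=
  ∑ i, ∑ j, w j i * (p i * (Real.log (q j + t * p i) - Real.log (q j)))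

lemma G_deriv (w : n → n → ℝ) (p q : n → ℝ) (hp : ∀ i, 0 < p i) (hq : ∀ i, 0 < q i)
    (t : ℝ) (ht : 0 ≤ t) :
    HasDerivAt (G w p q) (∑ i, ∑ j, w j i * (p i * p i / (q j + t * p i))) t := by
  unfold G
  refine HasDerivAt.fun_sum fun i _ => HasDerivAt.fun_sum fun j _ => HasDerivAt.const_mul _ ?_
  have := hp i; have := hq j
  have hne : q j + t * p i ≠ 0 := by positivity
  have h1 : HasDerivAt (fun t : ℝ => q j + t * p i) (p i) t := by
    simpa using ((hasDerivAt_id t).mul_const (p i)).const_add (q j)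
  have := ((h1.log hne).sub_const (Real.log (q j))).const_mul (p i)
  rwa [← mul_div_assoc] at this

lemma G_lim (w : n → n → ℝ) (p q : n → ℝ) (hp : ∀ i, 0 < p i) (hq : ∀ i, 0 < q i) :
    Tendsto (fun t => G w p q t - (∑ i, ∑ j, w j i * p i) * Real.log t) atTop
      (𝓝 (∑ i, ∑ j, w j i * (p i * (Real.log (p i) - Real.log (q j))))) := by
  have : ∀ t, G w p q t - (∑ i, ∑ j, w j i * p i) * Real.log t =
      ∑ i, ∑ j, w j i * (p i * ((Real.log (q j + t * p i) - Real.log t) - Real.log (q j))) := by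
    intro t
    unfold G
    simp only [Finset.sum_mul, ← Finset.sum_sub_distrib]
    refine Finset.sum_congr rfl fun i _ => Finset.sum_congr rfl fun j _ => ?_
    ring
  simp only [this]
  refine tendsto_finsetSum _ fun i _ => tendsto_finsetSum _ fun j _ =>
    ((Tendsto.sub_const ?_ _).const_mul _).const_mul _
  have := hp i; have := hq j
  have hlim : Tendsto (fun t : ℝ => Real.log (q j / t + p i)) atTop (𝓝 (Real.log (p i))) := by
    have h0 : Tendsto (fun t : ℝ => q j / t + p i) atTop (𝓝 (p i)) := by
      simpa using (tendsto_const_nhds.div_atTop tendsto_id).add_const (p i)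
    exact h0.log (hp i).ne'
  refine hlim.congr' ?_
  filter_upwards [eventually_gt_atTop 0] with t ht
  rw [← Real.log_div (by positivity) ht.ne']
  congr 1
  field_simp

/-- Data processing for conditional expectations. -/
lemma dpi {E : Matrix n n ℂ →ₗ[ℂ] Matrix n n ℂ} {X : StarSubalgebra ℂ (Matrix n n ℂ)}
    (h : IsCondExp E X) {a b : Matrix n n ℂ} (ha : a.PosDef) (hb : b.PosDef)
    (ha' : (E a).PosDef) (hb' : (E b).PosDef) :
    relent (E a) (E b) ≤ relent a b := by
  have dA := Diag.of_herm ha.1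
  have dB := Diag.of_herm hb.1
  have dA' := Diag.of_herm ha'.1
  have dB' := Diag.of_herm hb'.1
  have pA : ∀ i, 0 < ha.1.eigenvalues i := ha.eigenvalues_pos
  have pB : ∀ i, 0 < hb.1.eigenvalues i := hb.eigenvalues_pos
  have pA' : ∀ i, 0 < ha'.1.eigenvalues i := ha'.eigenvalues_pos
  have pB' : ∀ i, 0 < hb'.1.eigenvalues i := hb'.eigenvalues_pos
  rw [relent_eq dA dB, relent_eq dA' dB']
  have tA := dA.trace_eq dB.r
  have tA' := dA'.trace_eq dB'.r
  rw [h.trace_preserving, tA] at tA'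
  generalize (ha.1.eigenvectorUnitary : Matrix n n ℂ) = U at *
  generalize (hb.1.eigenvectorUnitary : Matrix n n ℂ) = V at *
  generalize (ha'.1.eigenvectorUnitary : Matrix n n ℂ) = U' at *
  generalize (hb'.1.eigenvectorUnitary : Matrix n n ℂ) = V' at *
  generalize ha.1.eigenvalues = p at *
  generalize hb.1.eigenvalues = q at *
  generalize ha'.1.eigenvalues = p' at *
  generalize hb'.1.eigenvalues = q' at *
  have L := G_lim (fun j i => Complex.normSq ((Vᴴ * U) j i)) p q pA pB
  have L' := G_lim (fun j i => Complex.normSq ((V'ᴴ * U') j i)) p' q' pA' pB'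
  refine le_of_tendsto_of_tendsto L' L ?_
  filter_upwards [eventually_ge_atTop 0] with t ht
  rw [← tA']
  refine sub_le_sub_right ?_ _
  have mono : MonotoneOn (fun t => G (fun j i => Complex.normSq ((Vᴴ * U) j i)) p q t
      - G (fun j i => Complex.normSq ((V'ᴴ * U') j i)) p' q' t) (Set.Ici 0) := by
    have hd : ∀ t : ℝ, 0 ≤ t → HasDerivAt _ _ t := fun t ht =>
      (G_deriv (fun j i => Complex.normSq ((Vᴴ * U) j i)) p q pA pB t ht).sub
      (G_deriv (fun j i => Complex.normSq ((V'ᴴ * U') j i)) p' q' pA' pB' t ht)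
    refine monotoneOn_of_hasDerivWithinAt_nonneg (convex_Ici 0)
      (fun t ht => (hd t ht).continuousAt.continuousWithinAt)
      (fun t ht => (hd t (interior_subset ht)).hasDerivWithinAt) ?_
    intro t ht
    have ht0 : (0 : ℝ) ≤ t := interior_subset ht
    obtain ⟨Y, hY⟩ := Fn_attained dA' dB' pA' pB' t ht0
    have h1 := Fn_mono h ha.posSemidef hb.posSemidef t ht0 Y
    have h2 := Fn_le dA dB pA pB t ht0 (E Y)
    rw [sub_nonneg, ← hY]
    exact h1.trans h2
  have := mono (Set.mem_Ici.2 le_rfl) (Set.mem_Ici.2 ht) ht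
  simp only [G, zero_mul, add_zero, sub_self, mul_zero, Finset.sum_const_zero] at this
  simp only [G]
  linarith

lemma relent_condexp {E : Matrix n n ℂ →ₗ[ℂ] Matrix n n ℂ}
    {X : StarSubalgebra ℂ (Matrix n n ℂ)}
    (h : IsCondExp E X) {a : Matrix n n ℂ} (ha' : (E a).IsHermitian) :
    relent a (E a) = vN (E a) - vN a := by
  have hm := mlog_mem ha' X (h.mem_image a)
  have := h.trace_cond _ hm a
  rw [Matrix.trace_mul_comm, Matrix.trace_mul_comm _ a] at this
  simp only [relent, vN, Matrix.mul_sub, Matrix.trace_sub, Complex.sub_re, this]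
  ring

lemma vN_lim {A : Matrix n n ℂ} (hA : A.IsHermitian) :
    Tendsto (fun e : ℝ => vN (A + (e : ℂ) • (1 : Matrix n n ℂ))) (𝓝[>] 0) (𝓝 (vN A)) := by
  have d := Diag.of_herm hA
  have d' : ∀ e : ℝ, Diag (A + (e : ℂ) • (1 : Matrix n n ℂ))
      (hA.eigenvectorUnitary : Matrix n n ℂ) (fun i => hA.eigenvalues i + e) := by
    intro e
    refine ⟨d.l, d.r, ?_⟩
    have : Matrix.diagonal (fun i => ((hA.eigenvalues i + e : ℝ) : ℂ)) =
        Matrix.diagonal (fun i => (hA.eigenvalues i : ℂ)) + (e : ℂ) • 1 := by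
      ext i j
      by_cases hij : i = j
      · subst hij; simp
      · simp [hij]
    rw [this, Matrix.mul_add, Matrix.add_mul, ← d.eq, Matrix.mul_smul, Matrix.smul_mul,
      Matrix.mul_one, d.r]
  simp only [fun e => (d' e).vN_eq, d.vN_eq]
  have hc : Continuous (fun e : ℝ => ∑ i, Real.negMulLog (hA.eigenvalues i + e)) := by
    refine continuous_finsetSum _ fun i _ => Real.continuous_negMulLog.comp (by fun_prop)
  have := hc.tendsto 0
  simp only [add_zero] at this
  exact this.mono_left nhdsWithin_le_nhds

lemma posDef_add {A : Matrix n n ℂ} (hA : A.PosSemidef) {e : ℝ} (he : 0 < e) :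
    (A + (e : ℂ) • (1 : Matrix n n ℂ)).PosDef := by
  refine Matrix.PosDef.posSemidef_add hA (Matrix.PosDef.one.smul ?_)
  exact_mod_cast he

end CSQ

/-- **Commuting-square entropic uncertainty relation** (Theorem 3 of Gao–Junge–Laracuente):
if `E_N ∘ E_T = E_T ∘ E_N = E_R` is a commuting square of conditional expectations onto
`*`-subalgebras `N`, `T`, `R` of the matrix algebra `M`, then for every density operator `ρ`,
`S(E_N(ρ)) + S(E_T(ρ)) ≥ S(ρ) + S(E_R(ρ))`. -/
theorem commuting_square_entropic_uncertainty
    {n : Type*} [Fintype n] [DecidableEq n]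
    (N T R : StarSubalgebra ℂ (Matrix n n ℂ))
    (EN ET ER : Matrix n n ℂ →ₗ[ℂ] Matrix n n ℂ)
    (hEN : IsCondExp EN N) (hET : IsCondExp ET T) (hER : IsCondExp ER R)
    (hNT : ∀ ρ : Matrix n n ℂ, EN (ET ρ) = ER ρ)
    (hTN : ∀ ρ : Matrix n n ℂ, ET (EN ρ) = ER ρ)
    (ρ : Matrix n n ℂ) (hρ : ρ.PosSemidef) (hρtr : ρ.trace = 1) :
    vN (EN ρ) + vN (ET ρ) ≥ vN ρ + vN (ER ρ) := by
  have pN := CSQ.E_psd hEN hρ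
  have pT := CSQ.E_psd hET hρ
  have pR := CSQ.E_psd hER hρ
  refine le_of_tendsto_of_tendsto ((CSQ.vN_lim hρ.1).add (CSQ.vN_lim pR.1))
    ((CSQ.vN_lim pN.1).add (CSQ.vN_lim pT.1)) ?_
  filter_upwards [self_mem_nhdsWithin] with e he
  have he : 0 < e := he
  have qρ := CSQ.posDef_add hρ he
  have qN := CSQ.posDef_add pN he
  have qT := CSQ.posDef_add pT he
  have qR := CSQ.posDef_add pR he
  have sN : EN (ρ + (e : ℂ) • 1) = EN ρ + (e : ℂ) • 1 := by
    rw [map_add, map_smul, hEN.unital]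
  have sT : ET (ρ + (e : ℂ) • 1) = ET ρ + (e : ℂ) • 1 := by
    rw [map_add, map_smul, hET.unital]
  have sR : ER (ρ + (e : ℂ) • 1) = ER ρ + (e : ℂ) • 1 := by
    rw [map_add, map_smul, hER.unital]
  rw [← sN] at qN ⊢
  rw [← sT] at qT ⊢
  rw [← sR] at qR ⊢
  generalize ρ + (e : ℂ) • 1 = a at *
  have h1 := CSQ.dpi hET qρ qN qT (by rw [hTN]; exact qR)
  rw [CSQ.relent_condexp hEN qN.1, hTN, ← hNT] at h1
  rw [CSQ.relent_condexp hEN (by rw [hNT]; exact qR.1), hNT] at h1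
  linarith
end
end
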